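/- For a unimodular triangulation Δ of the dilated simplex d·Δ_{n−1} using all lattice points as vertices, the number of j-dimensional faces is f_j = Σ_{i=0}^{j} (−1)^{i+j} binomial(j, i) · binomial(di+d+n−1, n−1). -/

import Mathlib

/-- The coordinatewise embedding of integer vectors into real vectors. -/
def toR {n : ℕ} (v : Fin n → ℤ) : Fin n → ℝ := fun i => (v i : ℝ)

/-- A unimodular triangulation of the dilated standard simplex `d·Δ_{n-1}`
using all lattice points as vertices, presented as the simplicial complex of
vertex sets of its faces. -/
structure UnimodularTriangulation (n d : ℕ) where
  /-- the collection of (vertex sets of) faces -/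
  cells : Finset (Finset (Fin n → ℤ))
  nonempty_cells : ∀ S ∈ cells, S.Nonempty
  /-- vertices are lattice points of `d·Δ_{n-1}` -/
  lattice : ∀ S ∈ cells, ∀ v ∈ S, (∀ i, 0 ≤ v i) ∧ ∑ i, v i = (d : ℤ)
  /-- faces of faces are faces -/
  down_closed : ∀ S ∈ cells, ∀ T, T ⊆ S → T.Nonempty → T ∈ cells
  /-- each face is a simplex -/
  indep : ∀ S ∈ cells, AffineIndependent ℝ (fun v : S => toR (v : Fin n → ℤ))
  /-- faces intersect face-to-face -/
  faceToFace : ∀ S ∈ cells, ∀ T ∈ cells,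
    convexHull ℝ (toR '' S) ∩ convexHull ℝ (toR '' T) = convexHull ℝ (toR '' ((S ∩ T : Finset (Fin n → ℤ)) : Set (Fin n → ℤ)))
  /-- the faces cover the simplex `d·Δ_{n-1}` -/
  covers : (⋃ S ∈ cells, convexHull ℝ (toR '' S)) =
    {x : Fin n → ℝ | (∀ i, 0 ≤ x i) ∧ ∑ i, x i = (d : ℝ)}
  /-- every lattice point of `d·Δ_{n-1}` is a vertex -/
  allVertices : ∀ v : Fin n → ℤ, (∀ i, 0 ≤ v i) → ∑ i, v i = (d : ℤ) → {v} ∈ cells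
  /-- maximal faces are unimodular simplices: the difference vectors of any
  full-dimensional face generate the full lattice of integer vectors with
  coordinate sum zero -/
  unimodular : ∀ S ∈ cells, S.card = n → ∀ v₀ ∈ S,
    Submodule.span ℤ ((fun v => v - v₀) '' (S : Set (Fin n → ℤ))) =
      LinearMap.ker (∑ i : Fin n, LinearMap.proj (R := ℤ) (φ := fun _ : Fin n => ℤ) i)

/-- Strong compositions of `t + 1` indexed by a nonempty finset `s`. -/
lemma card_finsuppAntidiag_filter_support_eq {ι : Type*} [DecidableEq ι] {s : Finset ι}
    (hs : s.Nonempty) (t : ℕ) :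
    ((s.finsuppAntidiag (t + 1)).filter fun f => f.support = s).card =
      t.choose (s.card - 1) := by
  have hpos := hs.card_pos
  have sum_ge (f : ι →₀ ℕ) (hf : f.support = s) : s.card ≤ ∑ v ∈ s, f v := by
    rw [Finset.card_eq_sum_ones]
    refine Finset.sum_le_sum fun v hv => ?_
    rw [← hf, Finsupp.mem_support_iff] at hv
    omega
  by_cases hst : s.card ≤ t + 1
  · have key : ((s.finsuppAntidiag (t + 1)).filter fun f => f.support = s).card =
        (s.finsuppAntidiag (t + 1 - s.card)).card := by
      let e : ι →₀ ℕ := Finsupp.indicator s fun _ _ => 1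
      have he : ∀ v ∈ s, e v = 1 := fun v hv => by simp [e, hv]
      have he' : ∀ v ∉ s, e v = 0 := fun v hv => by simp [e, hv]
      have hes : ∑ v ∈ s, e v = s.card := by
        rw [Finset.sum_congr rfl he, Finset.card_eq_sum_ones]
      refine Finset.card_nbij' (fun f => f - e) (fun f => f + e) ?_ ?_ ?_ ?_
      · intro f hf
        simp only [Finset.coe_filter, Set.mem_ofPred_eq, Finset.mem_finsuppAntidiag] at hf
        simp only [Finset.mem_coe, Finset.mem_finsuppAntidiag]
        refine ⟨?_, fun v hv => ?_⟩
        · simp only [Finsupp.coe_tsub, Pi.sub_apply]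
          rw [Finset.sum_tsub_distrib s, hf.1.1, hes]
          intro v hv
          have := he v hv
          rw [← hf.2, Finsupp.mem_support_iff] at hv
          omega
        · rw [← hf.2]
          simp only [Finsupp.mem_support_iff, Finsupp.coe_tsub, Pi.sub_apply] at hv ⊢
          omega
      · intro f hf
        simp only [Finset.mem_coe, Finset.mem_finsuppAntidiag] at hf
        have hsupp : (f + e).support = s := by
          ext v
          simp only [Finsupp.mem_support_iff, Finsupp.add_apply]
          by_cases hv : v ∈ s
          · simp [he v hv, hv]
          · simp [he' v hv, hv, Finsupp.notMem_support_iff.1 fun h => hv (hf.2 h)]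
        simp only [Finset.coe_filter, Set.mem_ofPred_eq, Finset.mem_finsuppAntidiag]
        refine ⟨⟨?_, hsupp.subset⟩, hsupp⟩
        rw [Finsupp.coe_add]
        simp only [Pi.add_apply]
        rw [Finset.sum_add_distrib, hf.1, hes]
        omega
      · intro f hf
        simp only [Finset.coe_filter, Set.mem_ofPred_eq, Finset.mem_finsuppAntidiag] at hf
        ext v
        simp only [Finsupp.add_apply, Finsupp.coe_tsub, Pi.sub_apply]
        by_cases hv : v ∈ s
        · have := he v hv
          rw [← hf.2, Finsupp.mem_support_iff] at hv
          omega
        · simp [he' v hv]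
      · intro f _
        simp
    rw [key, Finset.card_finsuppAntidiag_nat_eq_choose,
      show s.card + (t + 1 - s.card) - 1 = t by omega]
    exact Nat.choose_symm_of_eq_add (by omega)
  · rw [Nat.choose_eq_zero_of_lt (by omega), Finset.card_eq_zero,
      Finset.filter_eq_empty_iff]
    intro f hf hf'
    have := sum_ge f hf'
    rw [Finset.mem_finsuppAntidiag] at hf
    exact hst (this.trans hf.1.le)

/-- Inversion of the expansion of an integer sequence in the binomial basis. -/
lemma coeff_eq_alternating_sum_of_eq_sum_choose (n : ℕ) (c L : ℕ → ℤ)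
    (h : ∀ t, L t = ∑ k ∈ Finset.range n, c k * (t.choose k : ℤ)) {j : ℕ} (hj : j < n) :
    c j = ∑ i ∈ Finset.range (j + 1), (-1 : ℤ) ^ (i + j) * (j.choose i) * L i := by
  have hL : L = ∑ k ∈ Finset.range n, c k • (fun x : ℕ => (x.choose k : ℤ)) := by
    ext t
    simp [h t]
  have h₁ := fwdDiff_iter_eq_sum_shift 1 L j 0
  have h₂ : (fwdDiff 1)^[j] L 0 = c j := by
    rw [hL, fwdDiff_iter_finsetSum, Finset.sum_apply]
    simp only [fwdDiff_iter_const_smul, Pi.smul_apply, fwdDiff_iter_choose_zero]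
    simp [hj]
  rw [← h₂, h₁]
  refine Finset.sum_congr rfl fun i hi => ?_
  have hi : i ≤ j := by simpa [Nat.lt_succ_iff] using hi
  have hsign : (-1 : ℤ) ^ (i + j) = (-1) ^ (j - i) := by
    obtain ⟨k, rfl⟩ := Nat.exists_eq_add_of_le hi
    rw [show i + (i + k) = 2 * i + k by ring, pow_add, pow_mul]
    simp
  simp [hsign]

lemma toR_injective {n : ℕ} : Function.Injective (toR : (Fin n → ℤ) → Fin n → ℝ) := by
  intro v w h
  ext i
  have := congrFun h i
  simp only [toR] at this
  exact_mod_cast this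

lemma mem_convexHull_toR {n : ℕ} {S : Finset (Fin n → ℤ)} {x : Fin n → ℝ} :
    x ∈ convexHull ℝ (toR '' (S : Set (Fin n → ℤ))) ↔
      ∃ w : (Fin n → ℤ) → ℝ, (∀ v ∈ S, 0 ≤ w v) ∧ ∑ v ∈ S, w v = 1 ∧
        ∑ v ∈ S, w v • toR v = x := by
  classical
  rw [← Finset.coe_image, Finset.mem_convexHull']
  simp only [Finset.forall_mem_image, Finset.sum_image toR_injective.injOn]
  constructor
  · rintro ⟨w, h⟩
    exact ⟨fun v => w (toR v), h⟩
  · rintro ⟨w, h⟩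
    refine ⟨fun y => w (Function.invFun toR y), ?_⟩
    simpa only [Function.leftInverse_invFun toR_injective _] using h

lemma isClosed_convexHull_toR {n : ℕ} (S : Finset (Fin n → ℤ)) :
    IsClosed (convexHull ℝ (toR '' (S : Set (Fin n → ℤ)))) :=
  (S.finite_toSet.image _).isClosed_convexHull (𝕜 := ℝ)

namespace UnimodularTriangulation

variable {n d : ℕ} (T : UnimodularTriangulation n d)

lemma sum_toR {S : Finset (Fin n → ℤ)} (hS : S ∈ T.cells) {v : Fin n → ℤ} (hv : v ∈ S) :
    ∑ i, toR v i = (d : ℝ) := by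
  have := (T.lattice S hS v hv).2
  simp only [toR]
  exact_mod_cast this

lemma linearIndependent (hd : 1 ≤ d) {S : Finset (Fin n → ℤ)} (hS : S ∈ T.cells) :
    LinearIndependent ℝ (fun v : S => toR (v : Fin n → ℤ)) := by
  rw [Fintype.linearIndependent_iff]
  intro g hg
  have hg0 : ∑ v, g v = 0 := by
    have h := congrArg (fun y : Fin n → ℝ => ∑ i, y i) hg
    simp only [Finset.sum_apply, Pi.smul_apply, smul_eq_mul, Pi.zero_apply,
      Finset.sum_const_zero] at h
    rw [Finset.sum_comm] at h
    simp only [← Finset.mul_sum, fun v : S => T.sum_toR hS v.2] at h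
    rw [← Finset.sum_mul] at h
    have : (d : ℝ) ≠ 0 := by positivity
    simpa [this] using h
  intro v
  exact affineIndependent_iff.1 (T.indep S hS) Finset.univ g hg0 hg v (Finset.mem_univ v)

lemma coeff_unique (hd : 1 ≤ d) {S : Finset (Fin n → ℤ)} (hS : S ∈ T.cells)
    {a b : (Fin n → ℤ) → ℝ} (h : ∑ v ∈ S, a v • toR v = ∑ v ∈ S, b v • toR v) :
    ∀ v ∈ S, a v = b v := by
  intro v hv
  have h0 : ∑ v : S, (a v - b v) • toR (v : Fin n → ℤ) = 0 := by
    rw [Finset.sum_coe_sort S (fun v => (a v - b v) • toR v)]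
    simp [sub_smul, h]
  have := Fintype.linearIndependent_iff.1 (T.linearIndependent hd hS) _ h0 ⟨v, hv⟩
  exact sub_eq_zero.1 this

lemma card_le (hd : 1 ≤ d) {S : Finset (Fin n → ℤ)} (hS : S ∈ T.cells) : S.card ≤ n := by
  simpa using (T.linearIndependent hd hS).fintype_card_le_finrank

lemma dense_notMem_span :
    Dense {y : Fin n → ℝ | ∀ S ∈ T.cells, S.card < n →
      y ∉ Submodule.span ℝ (toR '' (S : Set (Fin n → ℤ)))} := by
  refine MeasureTheory.Measure.dense_of_ae (μ := MeasureTheory.volume) ?_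
  rw [Filter.eventually_all_finset]
  intro S _
  by_cases hc : S.card < n
  · have hne : Submodule.span ℝ (toR '' (S : Set (Fin n → ℤ))) ≠ ⊤ := by
      intro htop
      classical
      have h := finrank_span_finset_le_card (R := ℝ) (S.image toR)
      rw [Set.finrank, Finset.coe_image, htop, finrank_top, Module.finrank_fin_fun] at h
      exact absurd (h.trans Finset.card_image_le) (by omega)
    have h := MeasureTheory.Measure.addHaar_submodule MeasureTheory.volume _ hne
    filter_upwards [MeasureTheory.measure_eq_zero_iff_ae_notMem.1 h] with y hy _ using hy
  · exact Filter.Eventually.of_forall fun y h => absurd h hc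

/-- The full-dimensional cells already cover the dilated simplex. -/
lemma exists_full_cell (hd : 1 ≤ d) {x : Fin n → ℝ} (hx : ∀ i, 0 ≤ x i)
    (hsum : ∑ i, x i = (d : ℝ)) :
    ∃ S ∈ T.cells, S.card = n ∧ x ∈ convexHull ℝ (toR '' (S : Set (Fin n → ℤ))) := by
  have hd0 : (0 : ℝ) < d := by positivity
  let F : Set (Fin n → ℝ) :=
    ⋃ S ∈ T.cells.filter fun S => S.card = n, convexHull ℝ (toR '' (S : Set (Fin n → ℤ)))
  have hF : IsClosed F := isClosed_biUnion_finset fun S _ => isClosed_convexHull_toR S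
  suffices x ∈ F by simpa [F, and_assoc] using this
  let p : (Fin n → ℝ) → Fin n → ℝ := fun y => (d / ∑ i, y i) • y
  have hpx : p x = x := by simp [p, hsum, hd0.ne']
  have hp : ContinuousAt p x := by
    have hne : ∑ i, x i ≠ 0 := by rw [hsum]; exact hd0.ne'
    fun_prop (disch := exact hne)
  let O : Set (Fin n → ℝ) := Set.univ.pi fun _ => Set.Ioi 0
  have hO : IsOpen O := isOpen_set_pi Set.finite_univ fun _ _ => isOpen_Ioi
  have hxO : x ∈ closure O := by
    simp only [O, closure_pi_set, closure_Ioi, Set.mem_univ_pi, Set.mem_Ici]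
    exact hx
  have hxD := closure_minimal (T.dense_notMem_span.open_subset_closure_inter hO)
    isClosed_closure hxO
  have := hp.continuousWithinAt.mem_closure (t := F) hxD ?_
  · rwa [hF.closure_eq, hpx] at this
  rintro y ⟨hyO, hy⟩
  have hy0 : ∀ i, 0 < y i := fun i => hyO i trivial
  have hn : (Finset.univ : Finset (Fin n)).Nonempty := by
    rw [Finset.nonempty_iff_ne_empty]
    intro h
    rw [h, Finset.sum_empty] at hsum
    exact hd0.ne hsum
  have hys : 0 < ∑ i, y i := Finset.sum_pos (fun i _ => hy0 i) hn
  have hc : 0 < d / ∑ i, y i := by positivity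
  have hmem : p y ∈ ⋃ S ∈ T.cells, convexHull ℝ (toR '' (S : Set (Fin n → ℤ))) := by
    rw [T.covers]
    refine ⟨fun i => (mul_pos hc (hy0 i)).le, ?_⟩
    simp only [p, Pi.smul_apply, smul_eq_mul, ← Finset.mul_sum]
    field_simp
  simp only [Set.mem_iUnion, exists_prop] at hmem
  obtain ⟨S, hS, hyS⟩ := hmem
  have hcard : S.card = n := by
    by_contra hne
    refine hy S hS (lt_of_le_of_ne (T.card_le hd hS) hne) ?_
    have := convexHull_min Submodule.subset_span (Submodule.convex _) hyS
    exact (Submodule.smul_mem_iff _ hc.ne').1 this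
  simp only [F, Set.mem_iUnion, exists_prop, Finset.mem_filter]
  exact ⟨S, ⟨hS, hcard⟩, hyS⟩

lemma mem_span_of_full_cell {S : Finset (Fin n → ℤ)} (hS : S ∈ T.cells) (hc : S.card = n)
    {x : Fin n → ℤ} {t : ℤ} (hx : ∑ i, x i = d * t) :
    x ∈ Submodule.span ℤ (S : Set (Fin n → ℤ)) := by
  obtain ⟨v₀, hv₀⟩ := T.nonempty_cells S hS
  have hker : x - t • v₀ ∈
      LinearMap.ker (∑ i : Fin n, LinearMap.proj (R := ℤ) (φ := fun _ : Fin n => ℤ) i) := by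
    simp [LinearMap.sum_apply, hx, ← Finset.mul_sum, (T.lattice S hS v₀ hv₀).2, mul_comm]
  rw [← T.unimodular S hS hc v₀ hv₀] at hker
  have hv₀' := Submodule.subset_span (R := ℤ) (s := (S : Set (Fin n → ℤ))) hv₀
  have hle : Submodule.span ℤ ((fun v => v - v₀) '' (S : Set (Fin n → ℤ))) ≤
      Submodule.span ℤ (S : Set (Fin n → ℤ)) := by
    rw [Submodule.span_le]
    rintro _ ⟨v, hv, rfl⟩
    exact sub_mem (Submodule.subset_span hv) hv₀'
  simpa using add_mem (hle hker) (Submodule.smul_mem _ t hv₀')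

/-- Lattice points of the dilation by `t` are nonnegative integer combinations of the vertices of
a cell, with coefficients summing to `t`. -/
lemma exists_finsupp (hd : 1 ≤ d) {x : Fin n → ℤ} {t : ℕ} (ht : 1 ≤ t) (hx : ∀ i, 0 ≤ x i)
    (hsum : ∑ i, x i = (d * t : ℤ)) :
    ∃ f : (Fin n → ℤ) →₀ ℕ, f.support ∈ T.cells ∧ ∑ v ∈ f.support, f v = t ∧
      ∑ v ∈ f.support, (f v : ℤ) • v = x := by
  classical
  have ht0 : (0 : ℝ) < t := by positivity
  have hsumR : ∑ i, (x i : ℝ) = d * t := by exact_mod_cast hsum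
  obtain ⟨S, hS, hc, hmem⟩ := T.exists_full_cell hd (x := (t : ℝ)⁻¹ • toR x)
    (fun i => mul_nonneg (by positivity) (by simpa [toR] using hx i))
    (by simp only [Pi.smul_apply, smul_eq_mul, toR, ← Finset.mul_sum, hsumR]; field_simp)
  obtain ⟨w, hw0, hw1, hwx⟩ := mem_convexHull_toR.1 hmem
  obtain ⟨m, -, hm⟩ := Submodule.mem_span_finset.1 (T.mem_span_of_full_cell hS hc hsum)
  have hmR : ∑ v ∈ S, (m v : ℝ) • toR v = toR x := by
    ext i
    have := congrFun hm i
    simp only [Finset.sum_apply, Pi.smul_apply, smul_eq_mul] at this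
    simp only [Finset.sum_apply, Pi.smul_apply, smul_eq_mul, toR]
    exact_mod_cast this
  have hmw : ∀ v ∈ S, (m v : ℝ) = t * w v := by
    refine T.coeff_unique hd hS (b := fun v => t * w v) ?_
    simp only [mul_smul, ← Finset.smul_sum, hwx]
    rw [hmR, smul_inv_smul₀ ht0.ne']
  have hm0 : ∀ v ∈ S, 0 ≤ m v := fun v hv => by
    have h : (0 : ℝ) ≤ m v := by rw [hmw v hv]; exact mul_nonneg ht0.le (hw0 v hv)
    exact_mod_cast h
  have hmt : ∑ v ∈ S, m v = t := by
    have h : ∑ v ∈ S, (m v : ℝ) = t := by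
      rw [Finset.sum_congr rfl hmw, ← Finset.mul_sum, hw1, mul_one]
    exact_mod_cast h
  let f : (Fin n → ℤ) →₀ ℕ := Finsupp.indicator S fun v _ => (m v).toNat
  have hf : ∀ v ∈ S, (f v : ℤ) = m v := fun v hv => by simp [f, hv, hm0 v hv]
  have hfS : f.support ⊆ S := Finsupp.support_indicator_subset _ _
  have hft : ∑ v ∈ f.support, f v = t := by
    rw [Finset.sum_subset hfS fun v _ hv => Finsupp.notMem_support_iff.1 hv]
    zify
    rw [Finset.sum_congr rfl hf, hmt]
  refine ⟨f, T.down_closed S hS _ hfS ?_, hft, ?_⟩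
  · rw [Finset.nonempty_iff_ne_empty]
    intro h
    rw [h, Finset.sum_empty] at hft
    omega
  · rw [Finset.sum_subset hfS fun v _ hv => by simp [Finsupp.notMem_support_iff.1 hv],
      ← hm]
    exact Finset.sum_congr rfl fun v hv => by rw [hf v hv]

lemma support_subset_of_sum_eq (hd : 1 ≤ d) {t : ℕ} (ht : 1 ≤ t) {f g : (Fin n → ℤ) →₀ ℕ}
    (hf : f.support ∈ T.cells) (hg : g.support ∈ T.cells)
    (hft : ∑ v ∈ f.support, f v = t) (hgt : ∑ v ∈ g.support, g v = t)
    (h : ∑ v ∈ f.support, (f v : ℝ) • toR v = ∑ v ∈ g.support, (g v : ℝ) • toR v) :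
    f.support ⊆ g.support := by
  have ht0 : (0 : ℝ) < t := by positivity
  have mem (k : (Fin n → ℤ) →₀ ℕ) (hkt : ∑ v ∈ k.support, k v = t) :
      (t : ℝ)⁻¹ • ∑ v ∈ k.support, (k v : ℝ) • toR v ∈
        convexHull ℝ (toR '' (k.support : Set (Fin n → ℤ))) := by
    refine mem_convexHull_toR.2 ⟨fun v => (t : ℝ)⁻¹ * k v, fun v _ => by positivity, ?_, ?_⟩
    · rw [← Finset.mul_sum, ← Nat.cast_sum, hkt, inv_mul_cancel₀ ht0.ne']
    · simp only [mul_smul, Finset.smul_sum]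
  have hmem := Set.mem_inter (mem f hft) (h ▸ mem g hgt)
  rw [T.faceToFace _ hf _ hg] at hmem
  obtain ⟨w, -, -, hw⟩ := mem_convexHull_toR.1 hmem
  intro v hv
  by_contra hvg
  have hw' : ∑ u ∈ f.support, (if u ∈ g.support then w u else 0) • toR u =
      ∑ u ∈ f.support, ((t : ℝ)⁻¹ * f u) • toR u := by
    simp only [mul_smul, ← Finset.smul_sum, ← hw, ite_smul, zero_smul]
    rw [← Finset.sum_filter, Finset.filter_mem_eq_inter]
  have := T.coeff_unique hd hf (a := fun u => if u ∈ g.support then w u else 0) hw' v hv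
  simp only [hvg, if_false] at this
  have hfv : (0 : ℝ) < f v := by
    exact_mod_cast Nat.pos_of_ne_zero (Finsupp.mem_support_iff.1 hv)
  exact (by positivity : (0 : ℝ) < (t : ℝ)⁻¹ * f v).ne this

lemma finsupp_unique (hd : 1 ≤ d) {t : ℕ} (ht : 1 ≤ t) {f g : (Fin n → ℤ) →₀ ℕ}
    (hf : f.support ∈ T.cells) (hg : g.support ∈ T.cells)
    (hft : ∑ v ∈ f.support, f v = t) (hgt : ∑ v ∈ g.support, g v = t)
    (h : ∑ v ∈ f.support, (f v : ℤ) • v = ∑ v ∈ g.support, (g v : ℤ) • v) : f = g := by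
  have hR : ∑ v ∈ f.support, (f v : ℝ) • toR v = ∑ v ∈ g.support, (g v : ℝ) • toR v := by
    ext i
    have := congrFun h i
    simp only [Finset.sum_apply, Pi.smul_apply, smul_eq_mul, toR] at this ⊢
    exact_mod_cast this
  have hsupp : f.support = g.support :=
    (T.support_subset_of_sum_eq hd ht hf hg hft hgt hR).antisymm
      (T.support_subset_of_sum_eq hd ht hg hf hgt hft hR.symm)
  rw [← hsupp] at hR
  have hfg := T.coeff_unique hd hf (a := fun v => (f v : ℝ)) (b := fun v => (g v : ℝ)) hR
  ext v
  by_cases hv : v ∈ f.support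
  · exact_mod_cast hfg v hv
  · rw [Finsupp.notMem_support_iff.1 hv, Finsupp.notMem_support_iff.1 (hsupp ▸ hv)]

/-- The lattice points of the dilation by `t + 1`, counted cell by cell. -/
lemma choose_eq_sum_cells (hn : 1 ≤ n) (hd : 1 ≤ d) (t : ℕ) :
    (d * t + d + n - 1).choose (n - 1) = ∑ S ∈ T.cells, t.choose (S.card - 1) := by
  classical
  have hcount : ((Finset.univ : Finset (Fin n)).finsuppAntidiag (d * (t + 1))).card =
      (d * t + d + n - 1).choose (n - 1) := by
    rw [Finset.card_finsuppAntidiag_nat_eq_choose, Finset.card_univ, Fintype.card_fin,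
      show n + d * (t + 1) - 1 = d * t + d + n - 1 by rw [mul_add, mul_one]; omega]
    exact Nat.choose_symm_of_eq_add (by rw [mul_add, mul_one]; omega)
  have hcells : ∑ S ∈ T.cells, t.choose (S.card - 1) = (T.cells.biUnion fun S =>
      (S.finsuppAntidiag (t + 1)).filter fun f => f.support = S).card := by
    rw [Finset.card_biUnion]
    · exact Finset.sum_congr rfl fun S hS =>
        (card_finsuppAntidiag_filter_support_eq (T.nonempty_cells S hS) t).symm
    · intro S _ S' _ hne
      rw [Function.onFun, Finset.disjoint_left]
      intro f hf hf'
      exact hne ((Finset.mem_filter.1 hf).2.symm.trans (Finset.mem_filter.1 hf').2)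
  have hmem (f : (Fin n → ℤ) →₀ ℕ) : (f ∈ T.cells.biUnion fun S =>
      (S.finsuppAntidiag (t + 1)).filter fun f => f.support = S) ↔
        f.support ∈ T.cells ∧ ∑ v ∈ f.support, f v = t + 1 := by
    simp only [Finset.mem_biUnion, Finset.mem_filter, Finset.mem_finsuppAntidiag]
    constructor
    · rintro ⟨S, hS, ⟨h, -⟩, rfl⟩
      exact ⟨hS, h⟩
    · rintro ⟨hS, h⟩
      exact ⟨_, hS, ⟨h, subset_rfl⟩, rfl⟩
  have hnonneg (f : (Fin n → ℤ) →₀ ℕ) (hf : f.support ∈ T.cells) (i : Fin n) :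
      0 ≤ (∑ v ∈ f.support, (f v : ℤ) • v) i := by
    simp only [Finset.sum_apply, Pi.smul_apply, smul_eq_mul]
    exact Finset.sum_nonneg fun v hv =>
      mul_nonneg (by positivity) ((T.lattice _ hf v hv).1 i)
  rw [← hcount, hcells]
  symm
  refine Finset.card_bij (fun f _ => Finsupp.equivFunOnFinite.symm
    fun i => ((∑ v ∈ f.support, (f v : ℤ) • v) i).toNat) ?_ ?_ ?_
  · intro f hf
    obtain ⟨hf, hft⟩ := (hmem f).1 hf
    rw [Finset.mem_finsuppAntidiag]
    refine ⟨?_, Finset.subset_univ _⟩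
    simp only [Finsupp.equivFunOnFinite_symm_apply_apply]
    zify
    simp only [Int.toNat_of_nonneg (hnonneg f hf _)]
    simp only [Finset.sum_apply, Pi.smul_apply, smul_eq_mul]
    rw [Finset.sum_comm]
    simp only [← Finset.mul_sum]
    rw [Finset.sum_congr rfl fun v hv => by rw [(T.lattice _ hf v hv).2], ← Finset.sum_mul,
      ← Nat.cast_sum, hft]
    push_cast
    ring
  · intro f hf g hg h
    obtain ⟨hf, hft⟩ := (hmem f).1 hf
    obtain ⟨hg, hgt⟩ := (hmem g).1 hg
    refine T.finsupp_unique hd (Nat.le_add_left 1 t) hf hg hft hgt ?_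
    ext i
    have := DFunLike.congr_fun h i
    simp only [Finsupp.equivFunOnFinite_symm_apply_apply] at this
    rw [← Int.toNat_of_nonneg (hnonneg f hf i), this, Int.toNat_of_nonneg (hnonneg g hg i)]
  · intro y hy
    rw [Finset.mem_finsuppAntidiag] at hy
    obtain ⟨f, hf, hft, hfx⟩ := T.exists_finsupp hd (x := fun i => (y i : ℤ))
      (Nat.le_add_left 1 t) (fun i => by positivity) (by exact_mod_cast hy.1)
    refine ⟨f, (hmem f).2 ⟨hf, hft⟩, ?_⟩
    ext i
    simp only [Finsupp.equivFunOnFinite_symm_apply_apply, hfx, Int.toNat_natCast]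

end UnimodularTriangulation

/-- The `f`-vector of a unimodular triangulation of `d·Δ_{n-1}` using all
lattice points: the number of `j`-dimensional faces equals
`∑_{i=0}^{j} (−1)^{i+j} C(j,i) C(di+d+n−1, n−1)`. -/
theorem f_vector_unimodular_triangulation (n d j : ℕ) (hn : 1 ≤ n) (hd : 1 ≤ d)
    (hj : j ≤ n - 1) (T : UnimodularTriangulation n d) :
    ((T.cells.filter fun S => S.card = j + 1).card : ℤ) =
      ∑ i ∈ Finset.range (j + 1),
        (-1 : ℤ) ^ (i + j) * (j.choose i) * ((d * i + d + n - 1).choose (n - 1)) := by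
  refine coeff_eq_alternating_sum_of_eq_sum_choose n
    (fun k => ((T.cells.filter fun S => S.card = k + 1).card : ℤ))
    (fun i => ((d * i + d + n - 1).choose (n - 1) : ℤ)) (fun t => ?_) (by omega)
  have hmaps : ∀ S ∈ T.cells, S.card - 1 ∈ Finset.range n := fun S hS => by
    have := T.card_le hd hS
    rw [Finset.mem_range]
    omega
  rw [T.choose_eq_sum_cells hn hd t, ← Finset.sum_fiberwise_of_maps_to hmaps, Nat.cast_sum]
  refine Finset.sum_congr rfl fun k _ => ?_
  rw [Finset.sum_congr rfl fun S hS => by rw [(Finset.mem_filter.1 hS).2], Finset.sum_const,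
    smul_eq_mul, Nat.cast_mul]
  congr 3
  refine Finset.filter_congr fun S hS => ?_
  have := (T.nonempty_cells S hS).card_pos
  omega
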